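/- arXiv:2209.14416 — 3 statements merged into one kernel-verified Lean document; each statement's English description precedes it below -/
import Mathlib

section
/- For every integer k ≥ 1, the following identities of operators on V^{⊗k} hold: →∏_{1≤i<j≤k} R^{(ij)}(j−i) = ←∏_{1≤i<j≤k} R^{(ij)}(j−i) = H_k · ∏_{j=1}^{k} j^{k−j+1}, and →∏_{1≤i<j≤k} R^{(ij)}(i−j) = ←∏_{1≤i<j≤k} R^{(ij)}(i−j) = A_k · (−1)^k ∏_{j=1}^{k} (−j)^{k−j+1}. -/
noncomputable section
namespace Paper

def parN (m : ℕ) (c : ℕ) : ℕ := if c < m then 0 else 1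
def par (m : ℕ) {N : ℕ} (a : Fin N) : ℕ := parN m a

variable {R : Type} [Ring R] {ι : Type} [Fintype ι] [DecidableEq ι] {N : ℕ}

def mpar (m : ℕ) (r : ι → Fin N) : ℕ := ∑ v, par m (r v)

def invExp (m : ℕ) (lt : ι → ι → Prop) [DecidableRel lt] (σ : Equiv.Perm ι)
    (s : ι → Fin N) : ℕ :=
  ∑ p ∈ Finset.univ.filter (fun p : ι × ι => lt p.1 p.2 ∧ lt (σ p.2) (σ p.1)),
    par m (s p.1) * par m (s p.2)

def permMat (m : ℕ) (lt : ι → ι → Prop) [DecidableRel lt] (σ : Equiv.Perm ι) :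
    Matrix (ι → Fin N) (ι → Fin N) R := fun r s =>
  if r = s ∘ σ.symm then (-1 : R) ^ invExp m lt σ s else 0

/-- The rational R-matrix `R^{(ij)}(u) = u + P^{(ij)}` acting in factors `i, j` of `V^{⊗k}`. -/
def RMat (m : ℕ) {N : ℕ} {k : ℕ} (i j : Fin k) (u : ℂ) :
    Matrix (Fin k → Fin N) (Fin k → Fin N) ℂ :=
  u • 1 + permMat m (· < ·) (Equiv.swap i j)

/-- Symmetrizer on `V^{⊗k}`. -/
def symmZ (m : ℕ) (N k : ℕ) : Matrix (Fin k → Fin N) (Fin k → Fin N) ℂ :=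
  ((k.factorial : ℂ))⁻¹ • ∑ σ : Equiv.Perm (Fin k), permMat m (· < ·) σ

/-- Antisymmetrizer on `V^{⊗k}`. -/
def asymmZ (m : ℕ) (N k : ℕ) : Matrix (Fin k → Fin N) (Fin k → Fin N) ℂ :=
  ((k.factorial : ℂ))⁻¹ •
    ∑ σ : Equiv.Perm (Fin k), (((Equiv.Perm.sign σ : ℤ) : ℂ)) • permMat m (· < ·) σ

/-- All pairs `(i,j)` with `i < j`, in lexicographic order of `(i,j)`. -/
def pairsIJ (k : ℕ) : List (Fin k × Fin k) :=
  (List.finRange k).flatMap fun i =>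
    (((List.finRange k).filter fun j => decide (i < j)).map fun j => (i, j))

/-- All pairs `(i,j)` with `i < j`, in lexicographic order of `(j,i)`. -/
def pairsJI (k : ℕ) : List (Fin k × Fin k) :=
  (List.finRange k).flatMap fun j =>
    (((List.finRange k).filter fun i => decide (i < j)).map fun i => (i, j))

theorem invExp_comp_symm_add (m : ℕ) {k : ℕ} (σ τ : Equiv.Perm (Fin k)) (s : Fin k → Fin N) :
    invExp m (· < ·) σ (s ∘ τ.symm) + invExp m (· < ·) τ s
      = invExp m (· < ·) (σ * τ) s
        + 2 * ∑ p : Fin k × Fin k, if p.1 < p.2 ∧ τ p.2 < τ p.1 ∧ σ (τ p.1) < σ (τ p.2) then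
            par m (s p.1) * par m (s p.2) else 0 := by
  have hpull : invExp m (· < ·) σ (s ∘ τ.symm)
      = ∑ p : Fin k × Fin k, if τ p.1 < τ p.2 ∧ σ (τ p.2) < σ (τ p.1) then
          par m (s p.1) * par m (s p.2) else 0 := by
    rw [invExp, Finset.sum_filter]
    exact (Fintype.sum_equiv (Equiv.prodCongr τ τ) _ _ fun p => by simp).symm
  have hsplit : invExp m (· < ·) σ (s ∘ τ.symm)
      = ∑ p : Fin k × Fin k,
          ((if p.1 < p.2 ∧ τ p.1 < τ p.2 ∧ σ (τ p.2) < σ (τ p.1) then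
            par m (s p.1) * par m (s p.2) else 0)
          + if p.1 < p.2 ∧ τ p.2 < τ p.1 ∧ σ (τ p.1) < σ (τ p.2) then
            par m (s p.1) * par m (s p.2) else 0) := by
    have hswap : (∑ p : Fin k × Fin k,
          if p.1 < p.2 ∧ τ p.2 < τ p.1 ∧ σ (τ p.1) < σ (τ p.2) then
            par m (s p.1) * par m (s p.2) else 0)
        = ∑ p : Fin k × Fin k,
          if p.2 < p.1 ∧ τ p.1 < τ p.2 ∧ σ (τ p.2) < σ (τ p.1) then
            par m (s p.1) * par m (s p.2) else 0 :=
      Fintype.sum_equiv (Equiv.prodComm _ _) _ _ fun p => by simp [mul_comm]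
    rw [Finset.sum_add_distrib, hswap, ← Finset.sum_add_distrib, hpull]
    refine Finset.sum_congr rfl fun p _ => ?_
    rcases lt_trichotomy p.1 p.2 with h | h | h
    · simp [h, h.not_gt]
    · simp [h]
    · simp [h, h.not_gt]
  rw [hsplit, invExp, invExp, Finset.sum_filter, Finset.sum_filter, Finset.mul_sum,
    ← Finset.sum_add_distrib, ← Finset.sum_add_distrib]
  refine Finset.sum_congr rfl fun p _ => ?_
  by_cases h : p.1 < p.2
  · have hτ : τ p.1 ≠ τ p.2 := τ.injective.ne h.ne
    have hσ : σ (τ p.1) ≠ σ (τ p.2) := σ.injective.ne hτ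
    rcases hτ.lt_or_gt with h₁ | h₁ <;> rcases hσ.lt_or_gt with h₂ | h₂ <;>
      simp [h, h₁, h₂, h₁.not_gt, h₂.not_gt, two_mul]
  · simp [h]

theorem permMat_one (m k : ℕ) :
    permMat m (· < ·) (1 : Equiv.Perm (Fin k)) = (1 : Matrix (Fin k → Fin N) (Fin k → Fin N) R) := by
  ext r s
  have h : invExp m (· < ·) (1 : Equiv.Perm (Fin k)) s = 0 := by
    rw [invExp, Finset.sum_filter]
    refine Finset.sum_eq_zero fun p _ => if_neg ?_
    simpa using le_of_lt
  have hs : s ∘ (1 : Equiv.Perm (Fin k)).symm = s := rfl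
  simp [permMat, h, hs, Matrix.one_apply]

theorem permMat_mul (m : ℕ) {k : ℕ} (σ τ : Equiv.Perm (Fin k)) :
    (permMat m (· < ·) (σ * τ) : Matrix (Fin k → Fin N) (Fin k → Fin N) R)
      = permMat m (· < ·) σ * permMat m (· < ·) τ := by
  ext r s
  have hcomp : s ∘ (σ * τ).symm = (s ∘ τ.symm) ∘ σ.symm := rfl
  rw [Matrix.mul_apply, Finset.sum_eq_single (s ∘ τ.symm)]
  · simp only [permMat, hcomp, if_true]
    split_ifs
    · rw [← pow_add, invExp_comp_symm_add, pow_add, pow_mul]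
      simp
    · simp
  · intro q _ hq
    simp [permMat, hq]
  · simp

/-- The action of the symmetric group on the tensor power, as a representation by matrices. -/
def permMatHom (m N k : ℕ) :
    Equiv.Perm (Fin k) →* Matrix (Fin k → Fin N) (Fin k → Fin N) ℂ where
  toFun := permMat m (· < ·)
  map_one' := permMat_one m k
  map_mul' := permMat_mul m

theorem pairsIJ_succ (k : ℕ) :
    pairsIJ (k + 1) = (List.finRange k).map (fun j => (0, j.succ))
      ++ (pairsIJ k).map (Prod.map Fin.succ Fin.succ) := by
  simp [pairsIJ, List.finRange_succ, List.filter_map, List.map_flatMap, List.flatMap_map,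
    Function.comp_def]

theorem pairsJI_reverse (k : ℕ) :
    (pairsJI k).reverse = (pairsIJ k).map fun p => (p.2.rev, p.1.rev) := by
  rw [pairsJI, List.reverse_flatMap, List.finRange_reverse, pairsIJ]
  simp only [List.flatMap_map, List.map_flatMap, Function.comp_def, ← List.map_reverse,
    ← List.filter_reverse, List.finRange_reverse, List.filter_map, Fin.rev_lt_rev, List.map_map]

theorem length_pairsIJ (k : ℕ) : (pairsIJ k).length = k.choose 2 := by
  induction k with
  | zero => rfl
  | succ k ih => simp [pairsIJ_succ, ih, Nat.choose_succ_succ' k 1]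

theorem lt_of_mem_pairsIJ {k : ℕ} {p : Fin k × Fin k} (hp : p ∈ pairsIJ k) : p.1 < p.2 := by
  simp only [pairsIJ, List.mem_flatMap, List.mem_map, List.mem_filter] at hp
  obtain ⟨i, -, j, ⟨-, hij⟩, rfl⟩ := hp
  simpa using hij

/-- Permutations of `Fin k` acting on the successors in `Fin (k + 1)`. -/
def succPerm (k : ℕ) : Equiv.Perm (Fin k) →* Equiv.Perm (Fin (k + 1)) where
  toFun e := Equiv.Perm.decomposeFin.symm (0, e)
  map_one' := by
    ext x
    refine Fin.cases ?_ (fun i => ?_) x <;> simp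
  map_mul' e f := by
    ext x
    refine Fin.cases ?_ (fun i => ?_) x <;> simp

theorem succPerm_zero {k : ℕ} (e : Equiv.Perm (Fin k)) : succPerm k e 0 = 0 := by
  simp [succPerm]

theorem succPerm_succ {k : ℕ} (e : Equiv.Perm (Fin k)) (i : Fin k) :
    succPerm k e i.succ = (e i).succ := by
  simp [succPerm]

theorem succPerm_swap {k : ℕ} (i j : Fin k) :
    succPerm k (Equiv.swap i j) = Equiv.swap i.succ j.succ := by
  ext x
  refine Fin.cases ?_ (fun l => ?_) x
  · rw [succPerm_zero, Equiv.swap_apply_of_ne_of_ne] <;> simp [eq_comm]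
  · rw [succPerm_succ, Fin.succ_injective k |>.swap_apply]

theorem swap_mul_succPerm {k : ℕ} (p : Fin (k + 1)) (e : Equiv.Perm (Fin k)) :
    Equiv.swap 0 p * succPerm k e = Equiv.Perm.decomposeFin.symm (p, e) := by
  ext x
  refine Fin.cases ?_ (fun i => ?_) x
  · simp [succPerm_zero]
  · simp [succPerm_succ]

section Algebra

variable {A : Type*} [Ring A] [Algebra ℂ A]

theorem prod_ofFn_add_mul {k : ℕ} (d : ℕ) (hd : d ≠ 0) (s : Fin k → A) (E : A)
    (hs : ∀ i j, i ≠ j → s i * (s j * E) = s j * E) :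
    (List.ofFn fun j : Fin k => ((d + j : ℕ) : ℂ) • (1 : A) + s j).prod * E
      = (d.ascFactorial k : ℂ) • (E + (d : ℂ)⁻¹ • ∑ j, s j * E) := by
  induction k generalizing d with
  | zero => simp
  | succ k ih =>
    have hfun : (fun j : Fin k => ((d + (j.succ : Fin (k + 1)) : ℕ) : ℂ) • (1 : A) + s j.succ)
        = fun j : Fin k => ((d + 1 + j : ℕ) : ℂ) • (1 : A) + s j.succ := by
      funext j
      rw [Fin.val_succ, add_right_comm, add_assoc]
    have hfix : s 0 * ∑ j : Fin k, s j.succ * E = ∑ j : Fin k, s j.succ * E := by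
      rw [Finset.mul_sum]
      exact Finset.sum_congr rfl fun j _ => hs _ _ (Fin.succ_ne_zero j).symm
    have hd₀ : (d : ℂ) ≠ 0 := Nat.cast_ne_zero.2 hd
    have hd₁ : (d : ℂ) + 1 ≠ 0 := by exact_mod_cast d.succ_ne_zero
    have hasc : d.ascFactorial (k + 1) = d * (d + 1).ascFactorial k := by
      rw [Nat.ascFactorial_succ, ← Nat.succ_ascFactorial]
    rw [List.ofFn_succ, List.prod_cons, mul_assoc, hfun,
      ih (d + 1) d.succ_ne_zero _ fun i j hij => hs _ _ ((Fin.succ_injective k).ne hij),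
      Fin.sum_univ_succ, hasc]
    simp only [add_mul, mul_add, mul_smul_comm, smul_mul_assoc, one_mul, hfix, smul_add,
      Fin.val_zero, add_zero]
    push_cast
    match_scalars <;> field_simp

theorem prod_pairsIJ_eq {k : ℕ} (ρ : Equiv.Perm (Fin k) →* A) :
    ((pairsIJ k).map fun p => (((p.2 : ℕ) : ℂ) - ((p.1 : ℕ) : ℂ)) • (1 : A)
        + ρ (Equiv.swap p.1 p.2)).prod
      = (k.superFactorial : ℂ) • (k.factorial : ℂ)⁻¹ • ∑ σ, ρ σ := by
  induction k with
  | zero => simp [pairsIJ, Subsingleton.elim _ (1 : Equiv.Perm (Fin 0))]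
  | succ k ih =>
    set E : A := ∑ e, ρ (succPerm k e) with hE
    have hfix (e : Equiv.Perm (Fin k)) : ρ (succPerm k e) * E = E := by
      simp only [hE, Finset.mul_sum, ← map_mul]
      exact Fintype.sum_equiv (Equiv.mulLeft e) _ _ fun f => rfl
    have hsum : ∑ σ, ρ σ = E + ∑ j : Fin k, ρ (Equiv.swap 0 j.succ) * E := by
      rw [← Equiv.sum_comp Equiv.Perm.decomposeFin.symm, Fintype.sum_prod_type,
        Fin.sum_univ_succ]
      simp only [← swap_mul_succPerm, map_mul, ← Finset.mul_sum, ← hE]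
      rw [Equiv.swap_self, ← Equiv.Perm.one_def, map_one, one_mul]
    have hs (i j : Fin k) (hij : i ≠ j) : ρ (Equiv.swap 0 i.succ) * (ρ (Equiv.swap 0 j.succ) * E)
        = ρ (Equiv.swap 0 j.succ) * E := by
      have hconj : Equiv.swap 0 i.succ * Equiv.swap 0 j.succ
          = Equiv.swap 0 j.succ * succPerm k (Equiv.swap i j) := by
        rw [succPerm_swap, Equiv.mul_swap_eq_swap_mul (Equiv.swap 0 j.succ) i.succ j.succ,
          Equiv.swap_apply_right, Equiv.swap_apply_of_ne_of_ne (Fin.succ_ne_zero i)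
            ((Fin.succ_injective k).ne hij), Equiv.swap_comm i.succ]
      rw [← mul_assoc, ← map_mul, hconj, map_mul, mul_assoc, hfix]
    have htail := ih (ρ.comp (succPerm k))
    simp only [MonoidHom.comp_apply, succPerm_swap, ← hE] at htail
    have hhead := prod_ofFn_add_mul 1 one_ne_zero (fun j : Fin k => ρ (Equiv.swap 0 j.succ)) E hs
    rw [pairsIJ_succ, List.map_append, List.prod_append, List.map_map, List.map_map]
    have h₁ : (List.finRange k).map ((fun p : Fin (k + 1) × Fin (k + 1) =>
          (((p.2 : ℕ) : ℂ) - ((p.1 : ℕ) : ℂ)) • (1 : A) + ρ (Equiv.swap p.1 p.2)) ∘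
            fun j => (0, j.succ))
        = List.ofFn fun j : Fin k => ((1 + j : ℕ) : ℂ) • (1 : A) + ρ (Equiv.swap 0 j.succ) := by
      rw [List.ofFn_eq_map]
      simp [Function.comp_def, add_comm]
    have h₂ : (pairsIJ k).map ((fun p : Fin (k + 1) × Fin (k + 1) =>
          (((p.2 : ℕ) : ℂ) - ((p.1 : ℕ) : ℂ)) • (1 : A) + ρ (Equiv.swap p.1 p.2)) ∘
            Prod.map Fin.succ Fin.succ)
        = (pairsIJ k).map fun p => (((p.2 : ℕ) : ℂ) - ((p.1 : ℕ) : ℂ)) • (1 : A)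
          + ρ (Equiv.swap p.1.succ p.2.succ) := by
      simp [Function.comp_def]
    rw [h₁, h₂, htail, mul_smul_comm, mul_smul_comm, hhead, hsum, Nat.one_ascFactorial,
      Nat.superFactorial_succ]
    have hk : (k.factorial : ℂ) ≠ 0 := Nat.cast_ne_zero.2 k.factorial_ne_zero
    have hk' : ((k + 1).factorial : ℂ) ≠ 0 := Nat.cast_ne_zero.2 (k + 1).factorial_ne_zero
    rw [Nat.cast_one, inv_one, one_smul, inv_smul_smul₀ hk, Nat.cast_mul, mul_comm, mul_smul,
      smul_inv_smul₀ hk']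

theorem prod_pairsJI_reverse_eq {k : ℕ} (ρ : Equiv.Perm (Fin k) →* A) :
    ((pairsJI k).reverse.map fun p => (((p.2 : ℕ) : ℂ) - ((p.1 : ℕ) : ℂ)) • (1 : A)
        + ρ (Equiv.swap p.1 p.2)).prod
      = (k.superFactorial : ℂ) • (k.factorial : ℂ)⁻¹ • ∑ σ, ρ σ := by
  have h := prod_pairsIJ_eq (ρ.comp (MulAut.conj (Fin.revPerm : Equiv.Perm (Fin k))).toMonoidHom)
  have hsum : ∑ σ, ρ.comp (MulAut.conj (Fin.revPerm : Equiv.Perm (Fin k))).toMonoidHom σ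
      = ∑ σ, ρ σ :=
    Fintype.sum_equiv (MulAut.conj (Fin.revPerm : Equiv.Perm (Fin k))).toEquiv _ _ fun σ => rfl
  rw [hsum] at h
  rw [← h, pairsJI_reverse, List.map_map]
  congr 1
  refine List.map_congr_left fun p _ => ?_
  have hconj : MulAut.conj (Fin.revPerm : Equiv.Perm (Fin k)) (Equiv.swap p.1 p.2)
      = Equiv.swap p.2.rev p.1.rev := by
    rw [MulAut.conj_apply, Equiv.mul_swap_eq_swap_mul, mul_inv_cancel_right, Equiv.swap_comm]
    rfl
  have hcoe : (((p.1.rev : Fin k) : ℕ) : ℂ) - ((p.2.rev : Fin k) : ℕ)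
      = ((p.2 : ℕ) : ℂ) - ((p.1 : ℕ) : ℂ) := by
    rw [Fin.val_rev, Fin.val_rev, Nat.cast_sub p.1.isLt, Nat.cast_sub p.2.isLt]
    push_cast
    ring
  simp only [Function.comp_apply, MonoidHom.comp_apply, MulEquiv.coe_toMonoidHom, hcoe, hconj]

/-- A representation of the symmetric group twisted by the sign character. -/
def signTwist {k : ℕ} (ρ : Equiv.Perm (Fin k) →* A) : Equiv.Perm (Fin k) →* A where
  toFun σ := ((Equiv.Perm.sign σ : ℤ) : ℂ) • ρ σ
  map_one' := by simp
  map_mul' σ τ := by simp [smul_smul, mul_comm]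

theorem prod_map_sub_smul_add {k : ℕ} (ρ : Equiv.Perm (Fin k) →* A) (l : List (Fin k × Fin k))
    (hl : ∀ p ∈ l, p.1 ≠ p.2) :
    (l.map fun p => (((p.1 : ℕ) : ℂ) - ((p.2 : ℕ) : ℂ)) • (1 : A)
        + ρ (Equiv.swap p.1 p.2)).prod
      = (-1 : ℂ) ^ l.length • (l.map fun p => (((p.2 : ℕ) : ℂ) - ((p.1 : ℕ) : ℂ)) • (1 : A)
        + signTwist ρ (Equiv.swap p.1 p.2)).prod := by
  induction l with
  | nil => simp
  | cons p l ih =>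
    have hp : p.1 ≠ p.2 := hl p List.mem_cons_self
    rw [List.map_cons, List.prod_cons, ih fun q hq => hl q (List.mem_cons_of_mem _ hq),
      List.map_cons, List.prod_cons, List.length_cons, pow_succ, mul_smul, mul_smul_comm,
      ← smul_mul_assoc (-1 : ℂ)]
    congr 2
    simp only [signTwist, MonoidHom.coe_mk, OneHom.coe_mk, Equiv.Perm.sign_swap hp]
    push_cast
    module

end Algebra

theorem prod_pow_eq_superFactorial (k : ℕ) :
    ∏ j ∈ Finset.Icc 1 k, j ^ (k - j + 1) = k.superFactorial := by
  induction k with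
  | zero => rfl
  | succ k ih =>
    have h : ∏ j ∈ Finset.Icc 1 k, j ^ (k + 1 - j + 1)
        = k.superFactorial * ∏ j ∈ Finset.Icc 1 k, j := by
      rw [← ih, ← Finset.prod_mul_distrib]
      refine Finset.prod_congr rfl fun j hj => ?_
      rw [← pow_succ, Nat.sub_add_comm (Finset.mem_Icc.1 hj).2]
    have hfact : ∏ j ∈ Finset.Icc 1 k, j = k.factorial := by
      rw [← Finset.prod_range_add_one_eq_factorial, Finset.range_eq_Ico,
        Finset.prod_Ico_add' (fun j => j) 0 k 1]
      rfl
    rw [Finset.prod_Icc_succ_top (by simp), h, hfact,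
      Nat.superFactorial_succ, Nat.factorial_succ, Nat.sub_self]
    ring

theorem neg_one_pow_mul_prod_neg_pow (k : ℕ) :
    (-1 : ℂ) ^ k * ∏ j ∈ Finset.Icc 1 k, (-(j : ℂ)) ^ (k - j + 1)
      = (-1) ^ k.choose 2 * (k.superFactorial : ℂ) := by
  have hexp : ∑ j ∈ Finset.Icc 1 k, (k - j + 1) = k.choose 2 + k := by
    induction k with
    | zero => rfl
    | succ k ih =>
      have h : ∑ j ∈ Finset.Icc 1 k, (k + 1 - j + 1) = k.choose 2 + k + k := by
        have hstep : ∀ j ∈ Finset.Icc 1 k, k + 1 - j + 1 = k - j + 1 + 1 := fun j hj => by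
          rw [Nat.sub_add_comm (Finset.mem_Icc.1 hj).2]
        rw [Finset.sum_congr rfl hstep, Finset.sum_add_distrib, ih]
        simp
      rw [Finset.sum_Icc_succ_top (by simp), h, Nat.choose_succ_succ' k 1, Nat.choose_one_right]
      lia
  have hneg (j : ℕ) : (-(j : ℂ)) ^ (k - j + 1) = (-1) ^ (k - j + 1) * (j : ℂ) ^ (k - j + 1) :=
    neg_pow _ _
  simp only [hneg, Finset.prod_mul_distrib, Finset.prod_pow_eq_pow_sum, hexp,
    ← prod_pow_eq_superFactorial, Nat.cast_prod, Nat.cast_pow]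
  rw [← mul_assoc, ← pow_add, add_left_comm, pow_add _ _ (k + k), ← two_mul k, pow_mul]
  simp

theorem statement0 (m n k : ℕ) (hk : 1 ≤ k) :
    -- →∏_{i<j} R^{(ij)}(j-i) = ←∏_{i<j} R^{(ij)}(j-i) = H_k ∏_{j=1}^k j^{k-j+1}
    (((pairsIJ k).map fun p =>
        RMat (N := m + n) m p.1 p.2 (((p.2 : ℕ) : ℂ) - ((p.1 : ℕ) : ℂ))).prod
      = ((pairsJI k).reverse.map fun p =>
          RMat (N := m + n) m p.1 p.2 (((p.2 : ℕ) : ℂ) - ((p.1 : ℕ) : ℂ))).prod)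
    ∧ (((pairsIJ k).map fun p =>
        RMat (N := m + n) m p.1 p.2 (((p.2 : ℕ) : ℂ) - ((p.1 : ℕ) : ℂ))).prod
      = (∏ j ∈ Finset.Icc 1 k, ((j : ℂ)) ^ (k - j + 1)) • symmZ m (m + n) k)
    -- →∏_{i<j} R^{(ij)}(i-j) = ←∏_{i<j} R^{(ij)}(i-j) = A_k (-1)^k ∏_{j=1}^k (-j)^{k-j+1}
    ∧ (((pairsIJ k).map fun p =>
        RMat (N := m + n) m p.1 p.2 (((p.1 : ℕ) : ℂ) - ((p.2 : ℕ) : ℂ))).prod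
      = ((pairsJI k).reverse.map fun p =>
          RMat (N := m + n) m p.1 p.2 (((p.1 : ℕ) : ℂ) - ((p.2 : ℕ) : ℂ))).prod)
    ∧ (((pairsIJ k).map fun p =>
        RMat (N := m + n) m p.1 p.2 (((p.1 : ℕ) : ℂ) - ((p.2 : ℕ) : ℂ))).prod
      = ((-1 : ℂ) ^ k * ∏ j ∈ Finset.Icc 1 k, (-(j : ℂ)) ^ (k - j + 1)) • asymmZ m (m + n) k) := by
  let ρ := permMatHom m (m + n) k
  have hne : ∀ p ∈ pairsIJ k, p.1 ≠ p.2 := fun p hp => (lt_of_mem_pairsIJ hp).ne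
  have hne' : ∀ p ∈ (pairsJI k).reverse, p.1 ≠ p.2 := by
    rw [pairsJI_reverse]
    intro p hp
    obtain ⟨q, hq, rfl⟩ := List.mem_map.1 hp
    exact (Fin.rev_lt_rev.2 (lt_of_mem_pairsIJ hq)).ne
  have hlen : (pairsJI k).reverse.length = (pairsIJ k).length := by
    rw [pairsJI_reverse, List.length_map]
  refine ⟨(prod_pairsIJ_eq ρ).trans (prod_pairsJI_reverse_eq ρ).symm,
    (prod_pairsIJ_eq ρ).trans ?_, ?_, ?_⟩
  · rw [← prod_pow_eq_superFactorial]
    push_cast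
    rfl
  · refine (prod_map_sub_smul_add ρ _ hne).trans (.trans ?_ (prod_map_sub_smul_add ρ _ hne').symm)
    rw [hlen, prod_pairsIJ_eq, prod_pairsJI_reverse_eq]
  · refine (prod_map_sub_smul_add ρ _ hne).trans ?_
    rw [prod_pairsIJ_eq, length_pairsIJ, neg_one_pow_mul_prod_neg_pow, mul_smul]
    rfl

end Paper
end
end

section
/- In the super Yangian Y(gl_{m|n}): (1) for any 1 ≤ a, b ≤ N, all coefficients of the series [T_{aa}(u), T_{bb}(v)] lie in Y_+(gl_{m|n}); (2) if Z ∈ Y_+(gl_{m|n}), then all coefficients of the series Z·T_{aa}(u) lie in Y_+(gl_{m|n}); (3) all coefficients of Δ(T_{aa}(u)) − T_{aa}(u) ⊗ T_{aa}(u) and of Δ̃(T_{aa}(u)) − T_{aa}(u) ⊗ T_{aa}(u) lie in Y_+(gl_{m|n}) ⊗ Y(gl_{m|n}) + Y(gl_{m|n}) ⊗ Y_+(gl_{m|n}). -/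
noncomputable section
namespace Paper

open scoped TensorProduct

/-- Generators `T_{ab}^{(s+1)}` of the super Yangian. -/
abbrev YGen (N : ℕ) := Fin N × Fin N × ℕ

/-- `T_{ab}^{(s)}` in the free algebra (with `T^{(0)}_{ab} = δ_{ab}`). -/
def Tfree {N : ℕ} (a b : Fin N) : ℕ → FreeAlgebra ℂ (YGen N)
  | 0 => if a = b then 1 else 0
  | s + 1 => FreeAlgebra.ι ℂ (a, b, s)

/-- The RTT defining relations of `Y(gl_{m|n})`, in terms of the coefficients of the
generating series: for all `a,b,c,d,r,s`,
`[T_ab^{(r+1)}, T_cd^{(s)}] - [T_ab^{(r)}, T_cd^{(s+1)}]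
  = (-1)^{|a||c|+|a||d|+|c||d|} (T_cb^{(s)} T_ad^{(r)} - T_cb^{(r)} T_ad^{(s)})`
(super-commutators). -/
inductive YRel (m n : ℕ) :
    FreeAlgebra ℂ (YGen (m + n)) → FreeAlgebra ℂ (YGen (m + n)) → Prop
  | rtt (a b c d : Fin (m + n)) (r s : ℕ) :
      YRel m n
        ((Tfree a b (r + 1) * Tfree c d s -
            ((-1 : ℂ) ^ ((par m a + par m b) * (par m c + par m d))) •
              (Tfree c d s * Tfree a b (r + 1)))
          - (Tfree a b r * Tfree c d (s + 1) -
            ((-1 : ℂ) ^ ((par m a + par m b) * (par m c + par m d))) •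
              (Tfree c d (s + 1) * Tfree a b r)))
        (((-1 : ℂ) ^ (par m a * par m c + par m a * par m d + par m c * par m d)) •
          (Tfree c b s * Tfree a d r - Tfree c b r * Tfree a d s))

/-- The super Yangian `Y(gl_{m|n})`. -/
abbrev Yangian (m n : ℕ) := RingQuot (YRel m n)

/-- The coefficient `T_{ab}^{(s)}` of the generating series `T_{ab}(u)` in `Y(gl_{m|n})`. -/
def TT (m n : ℕ) (a b : Fin (m + n)) (s : ℕ) : Yangian m n :=
  RingQuot.mkAlgHom ℂ (YRel m n) (Tfree a b s)

/-- The left ideal `Y_+(gl_{m|n})` generated by the coefficients of `T_{ba}(u)`, `a < b`. -/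
def Yplus (m n : ℕ) : Ideal (Yangian m n) :=
  Ideal.span {x | ∃ a b : Fin (m + n), ∃ s : ℕ, (a : ℕ) < (b : ℕ) ∧ 1 ≤ s ∧ x = TT m n b a s}


/-- The subspace `Y_+ ⊗ Y + Y ⊗ Y_+` of `Y ⊗ Y`. -/
def mixedPlus (m n : ℕ) : Submodule ℂ (Yangian m n ⊗[ℂ] Yangian m n) :=
  Submodule.span ℂ {z | (∃ x ∈ Yplus m n, ∃ y, z = x ⊗ₜ[ℂ] y) ∨
    (∃ x, ∃ y ∈ Yplus m n, z = x ⊗ₜ[ℂ] y)}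

theorem TT_zero (m n : ℕ) (a b : Fin (m + n)) : TT m n a b 0 = if a = b then 1 else 0 := by
  unfold TT Tfree
  split_ifs <;> simp

/-- The RTT relations in the super Yangian. -/
theorem TT_rtt (m n : ℕ) (a b c d : Fin (m + n)) (r s : ℕ) :
    (TT m n a b (r + 1) * TT m n c d s -
        ((-1 : ℂ) ^ ((par m a + par m b) * (par m c + par m d))) •
          (TT m n c d s * TT m n a b (r + 1)))
      - (TT m n a b r * TT m n c d (s + 1) -
        ((-1 : ℂ) ^ ((par m a + par m b) * (par m c + par m d))) •
          (TT m n c d (s + 1) * TT m n a b r))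
    = ((-1 : ℂ) ^ (par m a * par m c + par m a * par m d + par m c * par m d)) •
        (TT m n c b s * TT m n a d r - TT m n c b r * TT m n a d s) := by
  have h := RingQuot.mkAlgHom_rel ℂ (YRel.rtt (m := m) (n := n) a b c d r s)
  simp only [map_sub, map_mul, map_smul] at h
  exact h

/-- When one of the two series is diagonal, the supercommutator is a commutator. -/
theorem TT_rtt_of_diag (m n : ℕ) (a b c d : Fin (m + n)) (h : a = b ∨ c = d) (r s : ℕ) :
    (TT m n a b (r + 1) * TT m n c d s - TT m n c d s * TT m n a b (r + 1))
      - (TT m n a b r * TT m n c d (s + 1) - TT m n c d (s + 1) * TT m n a b r)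
    = ((-1 : ℂ) ^ (par m a * par m c + par m a * par m d + par m c * par m d)) •
        (TT m n c b s * TT m n a d r - TT m n c b r * TT m n a d s) := by
  have he : Even ((par m a + par m b) * (par m c + par m d)) := by
    rcases h with rfl | rfl
    · exact (Even.add_self _).mul_right _
    · exact (Even.add_self _).mul_left _
  simpa only [he.neg_one_pow, one_smul] using TT_rtt m n a b c d r s

theorem TT_mem_Yplus (m n : ℕ) {a b : Fin (m + n)} (h : b < a) (s : ℕ) :
    TT m n a b s ∈ Yplus m n := by
  rcases s with _ | s
  · rw [TT_zero, if_neg h.ne']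
    exact zero_mem _
  · exact Ideal.subset_span ⟨b, a, s + 1, h, by omega, rfl⟩

theorem smul_mem_Yplus (m n : ℕ) (z : ℂ) {x : Yangian m n} (hx : x ∈ Yplus m n) :
    z • x ∈ Yplus m n := by
  rw [Algebra.smul_def]
  exact Ideal.mul_mem_left _ _ hx

theorem TT_zero_commute (m n : ℕ) (a b : Fin (m + n)) (x : Yangian m n) :
    TT m n a b 0 * x - x * TT m n a b 0 = 0 := by
  rw [TT_zero]
  split_ifs <;> simp

theorem commutator_mem_Yplus (m n : ℕ) {a b c d : Fin (m + n)} (h : a = b ∨ c = d)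
    (hda : d < a) (r s : ℕ) :
    TT m n a b r * TT m n c d s - TT m n c d s * TT m n a b r ∈ Yplus m n := by
  induction r generalizing s with
  | zero =>
    rw [TT_zero_commute]
    exact zero_mem _
  | succ r ih =>
    rw [sub_eq_iff_eq_add.mp (TT_rtt_of_diag m n a b c d h r s)]
    exact add_mem (smul_mem_Yplus m n _ (sub_mem
      (Ideal.mul_mem_left _ _ (TT_mem_Yplus m n hda r))
      (Ideal.mul_mem_left _ _ (TT_mem_Yplus m n hda s)))) (ih (s + 1))

theorem commutator_diag_self (m n : ℕ) (a : Fin (m + n)) (r s : ℕ) :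
    TT m n a a r * TT m n a a s - TT m n a a s * TT m n a a r = 0 := by
  induction r generalizing s with
  | zero => exact TT_zero_commute m n a a _
  | succ r ih =>
    rw [sub_eq_iff_eq_add.mp (TT_rtt_of_diag m n a a a a (Or.inl rfl) r s), ih,
      ← neg_sub, ih, neg_zero, smul_zero, add_zero]

theorem commutator_diag_mem_Yplus (m n : ℕ) (a b : Fin (m + n)) (r s : ℕ) :
    TT m n a a r * TT m n b b s - TT m n b b s * TT m n a a r ∈ Yplus m n := by
  rcases lt_trichotomy a b with h | rfl | h
  · rw [← neg_sub]
    exact neg_mem (commutator_mem_Yplus m n (Or.inl rfl) h s r)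
  · rw [commutator_diag_self]
    exact zero_mem _
  · exact commutator_mem_Yplus m n (Or.inl rfl) h r s

theorem TT_mul_diag_mem_Yplus (m n : ℕ) {x y : Fin (m + n)} (h : y < x) (a : Fin (m + n))
    (r s : ℕ) : TT m n x y r * TT m n a a s ∈ Yplus m n := by
  have hmem : TT m n a a s * TT m n x y r ∈ Yplus m n :=
    Ideal.mul_mem_left _ _ (TT_mem_Yplus m n h r)
  rcases lt_or_ge a x with hax | hax
  · have := add_mem (commutator_mem_Yplus m n (b := y) (c := a) (Or.inr rfl) hax r s) hmem
    rwa [sub_add_cancel] at this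
  · have := sub_mem hmem
      (commutator_mem_Yplus m n (b := a) (c := x) (Or.inl rfl) (h.trans_le hax) s r)
    rwa [sub_sub_cancel] at this

theorem mul_diag_mem_Yplus (m n : ℕ) {Z : Yangian m n} (hZ : Z ∈ Yplus m n) (a : Fin (m + n))
    (s : ℕ) : Z * TT m n a a s ∈ Yplus m n := by
  induction hZ using Submodule.span_induction with
  | mem x hx =>
    obtain ⟨y, x, r, h, -, rfl⟩ := hx
    exact TT_mul_diag_mem_Yplus m n h a r s
  | zero =>
    rw [zero_mul]
    exact zero_mem _
  | add x y _ _ hx hy =>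
    rw [add_mul]
    exact add_mem hx hy
  | smul w x _ hx =>
    rw [smul_eq_mul, mul_assoc]
    exact Ideal.mul_mem_left _ _ hx

theorem tmul_mem_mixedPlus (m n : ℕ) {a c : Fin (m + n)} (h : a ≠ c) (p q : ℕ) :
    TT m n a c p ⊗ₜ[ℂ] TT m n c a q ∈ mixedPlus m n := by
  rcases lt_or_gt_of_ne h with h | h
  · exact Submodule.subset_span (Or.inr ⟨_, _, TT_mem_Yplus m n h q, rfl⟩)
  · exact Submodule.subset_span (Or.inl ⟨_, TT_mem_Yplus m n h p, _, rfl⟩)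

theorem sum_sub_mem_of_ne {ι M : Type*} [Fintype ι] [AddCommGroup M] [Module ℂ M]
    (S : Submodule ℂ M) (f : ι → M) (a : ι) (h : ∀ c, c ≠ a → f c ∈ S) :
    ∑ c, f c - f a ∈ S := by
  classical
  rw [← Finset.add_sum_erase _ f (Finset.mem_univ a), add_sub_cancel_left]
  exact sum_mem fun c hc => h c (Finset.ne_of_mem_erase hc)

theorem statement4 (m n : ℕ) :
    -- (1) the coefficients of [T_aa(u), T_bb(v)] lie in Y_+
    (∀ (a b : Fin (m + n)) (r s : ℕ),
      TT m n a a r * TT m n b b s - TT m n b b s * TT m n a a r ∈ Yplus m n)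
    -- (2) Y_+ · (coefficients of T_aa(u)) ⊆ Y_+
    ∧ (∀ Z ∈ Yplus m n, ∀ (a : Fin (m + n)) (s : ℕ), Z * TT m n a a s ∈ Yplus m n)
    -- (3) coefficients of Δ(T_aa(u)) - T_aa(u) ⊗ T_aa(u) lie in Y_+ ⊗ Y + Y ⊗ Y_+ ...
    ∧ (∀ (a : Fin (m + n)) (s : ℕ),
        ((∑ c : Fin (m + n), ∑ p ∈ Finset.range (s + 1), TT m n c a p ⊗ₜ[ℂ] TT m n a c (s - p))
          - ∑ p ∈ Finset.range (s + 1), TT m n a a p ⊗ₜ[ℂ] TT m n a a (s - p)) ∈ mixedPlus m n)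
    -- ... and so do the coefficients of Δ̃(T_aa(u)) - T_aa(u) ⊗ T_aa(u)
    ∧ (∀ (a : Fin (m + n)) (s : ℕ),
        ((∑ c : Fin (m + n), ∑ p ∈ Finset.range (s + 1),
            ((-1 : ℂ) ^ ((par m a + par m c) * (par m c + par m a))) •
              (TT m n a c p ⊗ₜ[ℂ] TT m n c a (s - p)))
          - ∑ p ∈ Finset.range (s + 1), TT m n a a p ⊗ₜ[ℂ] TT m n a a (s - p)) ∈ mixedPlus m n) := by
  refine ⟨commutator_diag_mem_Yplus m n, fun Z hZ => mul_diag_mem_Yplus m n hZ,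
    fun a s => ?_, fun a s => ?_⟩
  · exact sum_sub_mem_of_ne _ (fun c => ∑ p ∈ Finset.range (s + 1),
      TT m n c a p ⊗ₜ[ℂ] TT m n a c (s - p)) a fun c hc =>
        sum_mem fun p _ => tmul_mem_mixedPlus m n hc p _
  · have h := sum_sub_mem_of_ne (mixedPlus m n) (fun c => ∑ p ∈ Finset.range (s + 1),
      ((-1 : ℂ) ^ ((par m a + par m c) * (par m c + par m a))) •
        (TT m n a c p ⊗ₜ[ℂ] TT m n c a (s - p))) a fun c hc =>
        sum_mem fun p _ => Submodule.smul_mem _ _ (tmul_mem_mixedPlus m n hc.symm p _)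
    simpa only [((Even.add_self (par m a)).mul_right (par m a + par m a)).neg_one_pow,
      one_smul] using h

end Paper
end
end

section
/- Let Q = diag(Q_1, …, Q_N) be diagonal. Under the isomorphism ϖ : Y(gl_{m|n}) → Y(gl_{n|m}), for every k ≥ 1: ϖ(𝔗_{k,Q}(u)) = (−1)^k 𝒯̃_{k,𝖰}(u) and ϖ(𝒯_{k,Q}(u)) = (−1)^k 𝔗̃_{k,𝖰}(u), where tilde denotes the corresponding transfer matrices for Y(gl_{n|m}) and 𝖰 = Σ_a Q_a E_{a′a′}. -/
noncomputable section
namespace Paper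

section Super
variable {R : Type} [Ring R] [Algebra ℂ R] {ι : Type} [Fintype ι] [DecidableEq ι] {N : ℕ}

def sMul (m : ℕ) (A B : Matrix (ι → Fin N) (ι → Fin N) R) :
    Matrix (ι → Fin N) (ι → Fin N) R := fun r t =>
  ∑ s : ι → Fin N, ((-1 : R) ^ ((mpar m s + mpar m t) * (mpar m r + mpar m s))) * A r s * B s t

def embed (m : ℕ) (lt : ι → ι → Prop) [DecidableRel lt] (v : ι) (f : Fin N → Fin N → R) :
    Matrix (ι → Fin N) (ι → Fin N) R := fun r s =>
  if ∀ w, w ≠ v → r w = s w then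
    ((-1 : R) ^ ((par m (r v) + par m (s v)) *
        ∑ w ∈ Finset.univ.filter (fun w => lt w v), par m (s w))) * f (r v) (s v)
  else 0

def strace (m : ℕ) (M : Matrix (ι → Fin N) (ι → Fin N) R) : R :=
  ∑ r : ι → Fin N, (-1 : R) ^ mpar m r * M r r

def shiftCoeff (z : ℂ) (p s : ℕ) : ℂ := ((p - 1).choose (p - s) : ℂ) * z ^ (p - s)

def serMul (m : ℕ) (F G : ℕ → Matrix (ι → Fin N) (ι → Fin N) R) :
    ℕ → Matrix (ι → Fin N) (ι → Fin N) R :=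
  fun p => ∑ q ∈ Finset.range (p + 1), sMul m (F q) (G (p - q))

def serOne : ℕ → Matrix (ι → Fin N) (ι → Fin N) R := fun p => if p = 0 then 1 else 0

def serProd (m : ℕ) (l : List (ℕ → Matrix (ι → Fin N) (ι → Fin N) R)) :
    ℕ → Matrix (ι → Fin N) (ι → Fin N) R := l.foldl (serMul m) serOne

def kron (Q : Matrix (Fin N) (Fin N) ℂ) : Matrix (ι → Fin N) (ι → Fin N) ℂ :=
  fun r s => ∏ v, Q (r v) (s v)

end Super

/-- The series `T^{(v, ι∪{∗})}(u - z)` as a matrix power series over the Yangian. -/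
def TfacY (m n : ℕ) {ι : Type} [Fintype ι] [DecidableEq ι]
    (lt : ι → ι → Prop) [DecidableRel lt] (v : ι) (z : ℂ) :
    ℕ → Matrix (ι → Fin (m + n)) (ι → Fin (m + n)) (Yangian m n) :=
  fun p => embed m lt v
    (fun a b => ∑ s ∈ Finset.range (p + 1),
      algebraMap ℂ (Yangian m n) (shiftCoeff z p s) * TT m n a b s)

/-- The series `T^{(k,k+1)}(u) ⋯ T^{(1,k+1)}(u-k+1)` on `V^{⊗k}` (Yangian in the last slot). -/
def TwedgeProd (m n k : ℕ) :
    ℕ → Matrix (Fin k → Fin (m + n)) (Fin k → Fin (m + n)) (Yangian m n) :=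
  serProd m (((List.finRange k).reverse).map fun i =>
    TfacY m n (· < ·) i ((k : ℂ) - 1 - (i : ℕ)))

/-- The series `T^{(1,k+1)}(u) ⋯ T^{(k,k+1)}(u-k+1)` on `V^{⊗k}`. -/
def TsymProd (m n k : ℕ) :
    ℕ → Matrix (Fin k → Fin (m + n)) (Fin k → Fin (m + n)) (Yangian m n) :=
  serProd m ((List.finRange k).map fun i => TfacY m n (· < ·) i ((i : ℕ) : ℂ))

/-- Coefficients of the transfer matrix `𝒯_{k,Q}(u) = str_{V^{∧k}}(Q^{∧k} T^{∧k}(u))`. -/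
def transferT (m n k : ℕ) (Q : Matrix (Fin (m + n)) (Fin (m + n)) ℂ) : ℕ → Yangian m n :=
  fun p => if k = 0 then (if p = 0 then 1 else 0) else
    strace m (sMul m ((asymmZ m (m + n) k).map (algebraMap ℂ (Yangian m n)))
      (sMul m ((kron (ι := Fin k) Q).map (algebraMap ℂ (Yangian m n))) (TwedgeProd m n k p)))

/-- Coefficients of the transfer matrix
`𝔗_{k,Q}(u) = str_{V^{⊗k}}(H_k Q^{(1)}⋯Q^{(k)} T^{(1,k+1)}(u)⋯T^{(k,k+1)}(u-k+1))`. -/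
def transferS (m n k : ℕ) (Q : Matrix (Fin (m + n)) (Fin (m + n)) ℂ) : ℕ → Yangian m n :=
  fun p => if k = 0 then (if p = 0 then 1 else 0) else
    strace m (sMul m ((symmZ m (m + n) k).map (algebraMap ℂ (Yangian m n)))
      (sMul m ((kron (ι := Fin k) Q).map (algebraMap ℂ (Yangian m n))) (TsymProd m n k p)))


/-- The index `a' = N + 1 - a` (zero-based: reversal), viewed in `gl_{n|m}` conventions. -/
def dualIdx {m n : ℕ} (a : Fin (m + n)) : Fin (n + m) := Fin.cast (Nat.add_comm m n) a.rev

lemma neg_one_pow_eq_of_zmod {R : Type} [Ring R] {a b : ℕ} (h : (a : ZMod 2) = b) :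
    (-1 : R) ^ a = (-1) ^ b := by
  rw [neg_one_pow_eq_pow_mod_two, neg_one_pow_eq_pow_mod_two (n := b),
    (ZMod.natCast_eq_natCast_iff' a b 2).mp h]

/-- The exponent of the sign of the entry `(s, t)` of a product of embedded matrices whose sites,
read from right to left, form the list `l`. -/
def crossExp (m : ℕ) {N k : ℕ} (s t : Fin k → Fin N) : List (Fin k) → ℕ
  | [] => 0
  | v :: l => crossExp m s t l + (par m (s v) + par m (t v)) *
      (∑ w with w < v, par m (s w) +
        ∑ w with w ∈ l ∧ v < w, (par m (s w) + par m (t w)))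

lemma crossExp_congr (m : ℕ) {N k : ℕ} (s : Fin k → Fin N) {t t' : Fin k → Fin N} :
    ∀ {l : List (Fin k)}, (∀ w ∈ l, t w = t' w) → crossExp m s t l = crossExp m s t' l
  | [], _ => rfl
  | v :: l, h => by
    have h' : ∀ w ∈ l, t w = t' w := fun w hw => h w (List.mem_cons_of_mem _ hw)
    rw [crossExp, crossExp, crossExp_congr m s h', h v List.mem_cons_self]
    congr 3
    refine Finset.sum_congr rfl fun w hw => ?_
    rw [h' w (Finset.mem_filter.mp hw).2.1]

lemma mpar_update (m : ℕ) {N k : ℕ} (t : Fin k → Fin N) (v : Fin k) (a : Fin N) :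
    ((mpar m (Function.update t v a) : ℕ) : ZMod 2) + (mpar m t : ℕ) = par m a + par m (t v) := by
  have h1 := Finset.add_sum_erase Finset.univ (fun w => (par m (t w) : ZMod 2)) (Finset.mem_univ v)
  have h2 := Finset.add_sum_erase Finset.univ
    (fun w => (par m (Function.update t v a w) : ZMod 2)) (Finset.mem_univ v)
  have h3 : ∑ w ∈ Finset.univ.erase v, (par m (Function.update t v a w) : ZMod 2) =
      ∑ w ∈ Finset.univ.erase v, (par m (t w) : ZMod 2) := by
    refine Finset.sum_congr rfl fun w hw => ?_
    rw [Function.update_of_ne (Finset.ne_of_mem_erase hw)]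
  simp only [mpar]
  push_cast
  rw [← h1, ← h2, h3, Function.update_self]
  linear_combination CharTwo.add_self_eq_zero (∑ w ∈ Finset.univ.erase v, (par m (t w) : ZMod 2))

lemma serProd_embed_apply {R : Type} [Ring R] [Algebra ℂ R] (m : ℕ) {N k : ℕ}
    (g : Fin k → ℕ → Fin N → Fin N → R) :
    ∀ {l : List (Fin k)}, l.Nodup → ∀ (p : ℕ) (s t : Fin k → Fin N),
      serProd m (l.reverse.map fun i p => embed m (· < ·) i (g i p)) p s t =
        if ∀ w, w ∉ l → s w = t w then
          (-1) ^ crossExp m s t l *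
            PowerSeries.coeff p (l.reverse.map fun i => PowerSeries.mk fun p => g i p (s i) (t i)).prod
        else 0
  | [], _, p, s, t => by
    by_cases hp : p = 0 <;> by_cases hst : s = t <;>
      simp [serProd, serOne, crossExp, PowerSeries.coeff_one, hp, hst, ← funext_iff]
  | v :: l, hl, p, s, t => by
    obtain ⟨hv, hl⟩ := List.nodup_cons.mp hl
    have ih := serProd_embed_apply m g hl
    set F : Fin k → ℕ → Matrix (Fin k → Fin N) (Fin k → Fin N) R :=
      fun i p => embed m (· < ·) i (g i p) with hF
    set r : Fin k → Fin N := Function.update t v (s v) with hr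
    have hrt : ∀ w, w ≠ v → r w = t w := fun w hw => Function.update_of_ne hw _ _
    have hrv : r v = s v := Function.update_self _ _ _
    have hstep : serProd m ((v :: l).reverse.map F) =
        serMul m (serProd m (l.reverse.map F)) (F v) := by
      simp [serProd, List.foldl_append]
    have hsingle : ∀ q, sMul m (serProd m (l.reverse.map F) q) (F v (p - q)) s t =
        (-1) ^ ((mpar m r + mpar m t) * (mpar m s + mpar m r)) *
          serProd m (l.reverse.map F) q s r * F v (p - q) r t := by
      intro q
      refine Finset.sum_eq_single r (fun r' _ hne => ?_) (fun h => absurd (Finset.mem_univ r) h)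
      by_cases h1 : ∀ w, w ≠ v → r' w = t w
      · have h2 : ¬ ∀ w, w ∉ l → s w = r' w := fun h => hne <| funext fun w => by
          by_cases hw : w = v
          · rw [hw, hrv, h v hv]
          · rw [h1 w hw, hrt w hw]
        rw [ih, if_neg h2, mul_zero, zero_mul]
      · simp only [hF, embed]
        rw [if_neg h1, mul_zero]
    have hcond : (∀ w, w ∉ l → s w = r w) ↔ ∀ w, w ∉ v :: l → s w = t w := by
      constructor
      · intro h w hw
        rw [List.mem_cons, not_or] at hw
        rw [h w hw.2, hrt w hw.1]
      · intro h w hw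
        by_cases hwv : w = v
        · rw [hwv, hrv]
        · rw [hrt w hwv, h w (by simp [hwv, hw])]
    rw [hstep, serMul, Matrix.sum_apply]
    simp only [hsingle, ih, hcond]
    by_cases hc : ∀ w, w ∉ v :: l → s w = t w
    · simp only [if_pos hc]
      have hlt : ∀ w ∈ l, r w = t w := fun w hw => hrt w fun h => hv (h ▸ hw)
      have hmap : (l.reverse.map fun i => PowerSeries.mk fun p => g i p (s i) (r i)) =
          l.reverse.map fun i => PowerSeries.mk fun p => g i p (s i) (t i) :=
        List.map_congr_left fun i hi => by rw [hlt i (List.mem_reverse.mp hi)]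
      have hexp : (-1 : R) ^ ((mpar m r + mpar m t) * (mpar m s + mpar m r)) *
          (-1) ^ crossExp m s t l * (-1) ^ ((par m (s v) + par m (t v)) *
            ∑ w with w < v, par m (t w)) = (-1) ^ crossExp m s t (v :: l) := by
        rw [← pow_add, ← pow_add]
        apply neg_one_pow_eq_of_zmod
        have e1 : ((mpar m r : ℕ) : ZMod 2) + (mpar m t : ℕ) = par m (s v) + par m (t v) :=
          mpar_update m t v (s v)
        have e2 : ((mpar m s : ℕ) : ZMod 2) + (mpar m r : ℕ) + ∑ w with w < v, (par m (t w) : ZMod 2)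
            = ∑ w with w < v, (par m (s w) : ZMod 2) +
              ∑ w with w ∈ l ∧ v < w, ((par m (s w) : ZMod 2) + par m (t w)) := by
          simp only [mpar]
          push_cast
          simp only [Finset.sum_filter, ← Finset.sum_add_distrib]
          refine Finset.sum_congr rfl fun w _ => ?_
          rcases lt_trichotomy w v with h | h | h
          · rw [hrt w h.ne, if_pos h, if_pos h, if_neg (fun h' => h'.2.asymm h)]
            linear_combination CharTwo.add_self_eq_zero (par m (t w) : ZMod 2)
          · rw [h, hrv]
            simp [CharTwo.add_self_eq_zero]
          · rw [hrt w h.ne', if_neg h.asymm, if_neg h.asymm]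
            by_cases hw : w ∈ l
            · simp [hw, h]
            · rw [hc w (by simp [hw, h.ne']), if_neg (fun h' => hw h'.1)]
              linear_combination CharTwo.add_self_eq_zero (par m (t w) : ZMod 2)
        rw [crossExp]
        push_cast
        rw [e1]
        linear_combination ((par m (s v) : ZMod 2) + par m (t v)) * e2
      rw [List.reverse_cons, List.map_append, List.prod_append, List.map_singleton,
        List.prod_singleton, PowerSeries.coeff_mul,
        Finset.Nat.sum_antidiagonal_eq_sum_range_succ_mk, ← hexp, Finset.mul_sum]
      refine Finset.sum_congr rfl fun q _ => ?_
      simp only [hF, embed]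
      rw [if_pos hrt, crossExp_congr m s hlt, hmap, hrv, PowerSeries.coeff_mk]
      have hcomm := fun (e : ℕ) (x : R) => ((Commute.neg_one_left x).pow_left e).eq
      simp only [mul_assoc]
      congr 2
      rw [← mul_assoc, ← mul_assoc, hcomm]
    · simp only [if_neg hc]
      simp

lemma crossExp_finRange_reverse (m : ℕ) {N k : ℕ} (s t : Fin k → Fin N) :
    crossExp m s t (List.finRange k).reverse =
      ∑ v, (par m (s v) + par m (t v)) * ∑ w with w < v, par m (s w) := by
  have key : ∀ l : List (Fin k), l.Pairwise (· > ·) → crossExp m s t l =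
      (l.map fun v => (par m (s v) + par m (t v)) * ∑ w with w < v, par m (s w)).sum := by
    intro l
    induction l with
    | nil => intro _; rfl
    | cons v l ih =>
      intro h
      rw [List.pairwise_cons] at h
      have h0 : (Finset.univ.filter fun w => w ∈ l ∧ v < w) = ∅ :=
        Finset.filter_eq_empty_iff.mpr fun w _ hw => hw.2.asymm (h.1 w hw.1)
      rw [crossExp, ih h.2, h0, Finset.sum_empty, add_zero, List.map_cons, List.sum_cons, add_comm]
  rw [key _ (List.pairwise_reverse.mpr (List.pairwise_lt_finRange k)), List.map_reverse,
    List.sum_reverse, ← List.ofFn_eq_map, List.sum_ofFn]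

lemma crossExp_finRange (m : ℕ) {N k : ℕ} (s t : Fin k → Fin N) :
    crossExp m s t (List.finRange k) =
      ∑ v, (par m (s v) + par m (t v)) * (∑ w with w < v, par m (s w) +
        ∑ w with v < w, (par m (s w) + par m (t w))) := by
  have key : ∀ l : List (Fin k), l.Pairwise (· < ·) → crossExp m s t l =
      (l.map fun v => (par m (s v) + par m (t v)) * (∑ w with w < v, par m (s w) +
        ∑ w with w ∈ l ∧ v < w, (par m (s w) + par m (t w)))).sum := by
    intro l
    induction l with
    | nil => intro _; rfl
    | cons v l ih =>
      intro h
      rw [List.pairwise_cons] at h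
      have h0 : (Finset.univ.filter fun w => w ∈ v :: l ∧ v < w) =
          Finset.univ.filter fun w => w ∈ l ∧ v < w :=
        Finset.filter_congr fun w _ => by
          rw [List.mem_cons]
          exact ⟨fun hw => ⟨hw.1.resolve_left hw.2.ne', hw.2⟩, fun hw => ⟨Or.inr hw.1, hw.2⟩⟩
      have h1 : ∀ u ∈ l, (Finset.univ.filter fun w => w ∈ v :: l ∧ u < w) =
          Finset.univ.filter fun w => w ∈ l ∧ u < w := fun u hu =>
        Finset.filter_congr fun w _ => by
          rw [List.mem_cons]
          exact ⟨fun hw => ⟨hw.1.resolve_left fun e => hw.2.asymm (e ▸ h.1 u hu), hw.2⟩,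
            fun hw => ⟨Or.inr hw.1, hw.2⟩⟩
      rw [crossExp, ih h.2, List.map_cons, List.sum_cons, h0, add_comm]
      congr 2
      exact List.map_congr_left fun u hu => by rw [h1 u hu]
  rw [key _ (List.pairwise_lt_finRange k), ← List.ofFn_eq_map, List.sum_ofFn]
  simp

lemma sign_eq_neg_one_pow {k : ℕ} (σ : Equiv.Perm (Fin k)) :
    (((Equiv.Perm.sign σ : ℤ) : ℂ)) = (-1) ^ (Finset.univ.filter
      fun p : Fin k × Fin k => p.1 < p.2 ∧ σ p.2 < σ p.1).card := by
  rw [Equiv.Perm.sign_eq_prod_prod_Ioi, ← Finset.prod_const, Finset.prod_filter,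
    Fintype.prod_prod_type]
  push_cast
  refine Finset.prod_congr rfl fun i _ => ?_
  rw [← Finset.filter_lt_eq_Ioi, Finset.prod_filter]
  refine Finset.prod_congr rfl fun j _ => ?_
  by_cases h : i < j
  · rcases lt_or_gt_of_ne (σ.injective.ne h.ne) with h' | h'
    · simp [h, h', h'.asymm]
    · simp [h, h', h'.asymm]
  · simp [h]

/-- The identity modulo `2` behind the matching of signs: `x` holds the parities of a row
multi-index and `y` those of the corresponding column multi-index. -/
lemma parity_identity {k : ℕ} (σ : Equiv.Perm (Fin k)) (x y : Fin k → ZMod 2)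
    (hy : ∀ i, y (σ i) = x i) :
    ∑ i, x i + (∑ i, ∑ j, if i < j ∧ σ j < σ i then x i * x j else 0) +
        (∑ j, (x j + y j) * ∑ i, if i < j then x i else 0) +
        ∑ i, ((1 + x i) * (1 + y i) + (1 + y i)) =
      k + ∑ i, (1 + y i) + (∑ i, ∑ j, if i < j ∧ σ j < σ i then 1 else 0) +
        (∑ i, ∑ j, if i < j ∧ σ j < σ i then (1 + x i) * (1 + x j) else 0) +
        (∑ i, (x i + y i) * ∑ j, if i < j then 1 + y j else 0) +
        ∑ i, (x i + y i) * ∑ j, if i < j then x j + y j else 0 := by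
  have two : (2 : ZMod 2) = 0 := rfl
  have hinv : (∑ i, ∑ j, if i < j ∧ σ j < σ i then x i * x j else 0) +
      (∑ i, ∑ j, if i < j ∧ σ j < σ i then 1 else 0) +
      (∑ i, ∑ j, if i < j ∧ σ j < σ i then (1 + x i) * (1 + x j) else 0) =
      ∑ i, ∑ j, if i < j then x i + y i else 0 := by
    have h1 : (∑ i, ∑ j, if i < j ∧ σ j < σ i then x i * x j else 0) +
        (∑ i, ∑ j, if i < j ∧ σ j < σ i then 1 else 0) +
        (∑ i, ∑ j, if i < j ∧ σ j < σ i then (1 + x i) * (1 + x j) else 0) =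
        (∑ i, ∑ j, if i < j ∧ σ j < σ i then x i else 0) +
          ∑ i, ∑ j, if i < j ∧ σ j < σ i then x j else 0 := by
      simp only [← Finset.sum_add_distrib]
      refine Finset.sum_congr rfl fun i _ => Finset.sum_congr rfl fun j _ => ?_
      split_ifs
      · linear_combination (x i * x j + 1) * two
      · ring
    have h2 : (∑ i, ∑ j, if i < j then x i + y i else 0) =
        (∑ i, ∑ j, if i < j then x i else 0) + ∑ i, ∑ j, if σ i < σ j then x i else 0 := by
      have : (∑ i, ∑ j, if i < j then y i else 0) = ∑ i, ∑ j, if σ i < σ j then x i else 0 := by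
        rw [← Equiv.sum_comp σ]
        refine Finset.sum_congr rfl fun i _ => ?_
        rw [← Equiv.sum_comp σ, hy]
      rw [← this]
      simp only [← Finset.sum_add_distrib]
      refine Finset.sum_congr rfl fun i _ => Finset.sum_congr rfl fun j _ => ?_
      split_ifs <;> simp
    rw [h1, h2, Finset.sum_comm (f := fun i j => if i < j ∧ σ j < σ i then x j else 0)]
    simp only [← Finset.sum_add_distrib]
    refine Finset.sum_congr rfl fun i _ => Finset.sum_congr rfl fun j _ => ?_
    rcases lt_trichotomy i j with h | h | h
    · rcases lt_or_gt_of_ne (σ.injective.ne h.ne) with h' | h'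
      · simp [h, h', h.asymm, h'.asymm, CharTwo.add_self_eq_zero]
      · simp [h, h', h.asymm, h'.asymm]
    · simp [h]
    · rcases lt_or_gt_of_ne (σ.injective.ne h.ne) with h' | h'
      · simp [h, h', h.asymm, h'.asymm]
      · simp [h, h', h.asymm, h'.asymm]
  have hxy : ∑ i, y i = ∑ i, x i := by
    rw [← Equiv.sum_comp σ]
    exact Finset.sum_congr rfl fun i _ => hy i
  have hprod : (∑ i, ∑ j, if i < j then x i * y j + y i * x j else 0) + ∑ i, x i * y i =
      ∑ i, x i := by
    have h1 : ∀ z : ZMod 2, z * z = z := by decide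
    have h2 : (∑ i, ∑ j, if i < j then x i * y j + y i * x j else 0) =
        (∑ i, ∑ j, if i < j then x i * y j else 0) + ∑ i, ∑ j, if j < i then x i * y j else 0 := by
      rw [Finset.sum_comm (f := fun i j => if j < i then x i * y j else 0)]
      simp only [← Finset.sum_add_distrib]
      refine Finset.sum_congr rfl fun i _ => Finset.sum_congr rfl fun j _ => ?_
      split_ifs
      · ring
      · ring
    have h3 : ∑ i, x i * y i = ∑ i, ∑ j, if i = j then x i * y j else 0 := by simp
    refine Eq.trans ?_ (show (∑ i, x i) * ∑ i, y i = ∑ i, x i by rw [hxy, h1])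
    rw [Finset.sum_mul_sum, h2, h3]
    simp only [← Finset.sum_add_distrib]
    refine Finset.sum_congr rfl fun i _ => Finset.sum_congr rfl fun j _ => ?_
    rcases lt_trichotomy i j with h | h | h
    · simp [h, h.asymm, h.ne]
    · simp [h]
    · simp [h, h.asymm, h.ne']
  have hcross : (∑ j, (x j + y j) * ∑ i, if i < j then x i else 0) +
      (∑ i, (x i + y i) * ∑ j, if i < j then 1 + y j else 0) +
      (∑ i, (x i + y i) * ∑ j, if i < j then x j + y j else 0) =
      (∑ i, ∑ j, if i < j then x i * y j + y i * x j else 0) +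
        ∑ i, ∑ j, if i < j then x i + y i else 0 := by
    simp only [Finset.mul_sum]
    rw [Finset.sum_comm]
    simp only [← Finset.sum_add_distrib]
    refine Finset.sum_congr rfl fun i _ => Finset.sum_congr rfl fun j _ => ?_
    split_ifs
    · linear_combination (x i * x j + x i * y j + y i * y j) * two
    · ring
  have hdiag : ∑ i, ((1 + x i) * (1 + y i) + (1 + y i)) = ∑ i, x i + ∑ i, x i * y i := by
    rw [← Finset.sum_add_distrib]
    refine Finset.sum_congr rfl fun i _ => ?_
    linear_combination (1 + y i) * two
  have hbar : ∑ i, (1 + y i) = k + ∑ i, x i := by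
    rw [Finset.sum_add_distrib, hxy]
    simp
  rw [hdiag, hbar]
  linear_combination hinv + hprod + hcross + (∑ i, x i - k +
    (∑ i, ∑ j, if i < j then x i + y i else 0) -
    (∑ i, ∑ j, if i < j ∧ σ j < σ i then 1 else 0) -
    (∑ i, ∑ j, if i < j ∧ σ j < σ i then (1 + x i) * (1 + x j) else 0) -
    (∑ i, (x i + y i) * ∑ j, if i < j then 1 + y j else 0) -
    (∑ i, (x i + y i) * ∑ j, if i < j then x j + y j else 0)) * two

lemma neg_one_pow_mul_eq_smul {R : Type} [Ring R] [Algebra ℂ R] (e : ℕ) (x : R) :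
    (-1 : R) ^ e * x = ((-1 : ℂ) ^ e) • x := by
  rw [Algebra.smul_def, map_pow, map_neg, map_one]

/-- The supertrace of `Z Q^{⊗k} M`, for `Q` diagonal and `Z` in the image of the group algebra of
the symmetric group, as a sum over permutations and multi-indices. -/
lemma strace_sMul_kron_diagonal {R : Type} [Ring R] [Algebra ℂ R] (m : ℕ) {N k : ℕ}
    (z : ℂ) (c : Equiv.Perm (Fin k) → ℂ) (d : Fin N → ℂ)
    (M : Matrix (Fin k → Fin N) (Fin k → Fin N) R) :
    strace m (sMul m
      ((z • ∑ σ : Equiv.Perm (Fin k), c σ • permMat m (· < ·) σ).map (algebraMap ℂ R))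
      (sMul m ((kron (ι := Fin k) (Matrix.diagonal d)).map (algebraMap ℂ R)) M)) =
      z • ∑ σ : Equiv.Perm (Fin k), ∑ s : Fin k → Fin N,
        (c σ * (-1) ^ (mpar m s + invExp m (· < ·) σ s) * ∏ v, d (s v)) • M s (s ∘ σ.symm) := by
  have hkron : ∀ s t, sMul m ((kron (ι := Fin k) (Matrix.diagonal d)).map (algebraMap ℂ R)) M s t =
      (∏ v, d (s v)) • M s t := by
    intro s t
    refine (Finset.sum_eq_single s (fun r _ hne => ?_)
      fun h => absurd (Finset.mem_univ s) h).trans ?_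
    · obtain ⟨v, hv⟩ := Function.ne_iff.mp hne
      have : kron (ι := Fin k) (Matrix.diagonal d) s r = 0 :=
        Finset.prod_eq_zero (Finset.mem_univ v) (Matrix.diagonal_apply_ne _ hv.symm)
      rw [Matrix.map_apply, this, map_zero, mul_zero, zero_mul]
    · have h1 : (-1 : R) ^ ((mpar m s + mpar m t) * (mpar m s + mpar m s)) = 1 :=
        Even.neg_one_pow (Even.mul_left ⟨_, rfl⟩ _)
      rw [h1, one_mul, Matrix.map_apply, Algebra.smul_def]
      simp [kron]
  have hmpar : ∀ (σ : Equiv.Perm (Fin k)) (s : Fin k → Fin N), mpar m (s ∘ σ.symm) = mpar m s :=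
    fun σ s => Equiv.sum_comp σ.symm fun v => par m (s v)
  calc _ = ∑ t : Fin k → Fin N, ∑ s : Fin k → Fin N, ((-1 : ℂ) ^ mpar m t *
        (-1) ^ ((mpar m s + mpar m t) * (mpar m t + mpar m s)) *
        (z * ∑ σ : Equiv.Perm (Fin k), c σ * permMat m (· < ·) σ t s) * ∏ v, d (s v)) • M s t := by
        refine Finset.sum_congr rfl fun t _ => ?_
        rw [sMul, Finset.mul_sum]
        refine Finset.sum_congr rfl fun s _ => ?_
        rw [hkron, mul_assoc (_ ^ _), neg_one_pow_mul_eq_smul, neg_one_pow_mul_eq_smul,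
          Matrix.map_apply, ← Algebra.smul_def, smul_smul, smul_smul, smul_smul,
          Matrix.smul_apply, Matrix.sum_apply]
        simp only [Matrix.smul_apply, smul_eq_mul, mul_assoc]
    _ = ∑ t : Fin k → Fin N, ∑ s : Fin k → Fin N, ∑ σ : Equiv.Perm (Fin k),
        if t = s ∘ σ.symm then
          z • (c σ * (-1) ^ (mpar m s + invExp m (· < ·) σ s) * ∏ v, d (s v)) • M s (s ∘ σ.symm)
        else 0 := by
        refine Finset.sum_congr rfl fun t _ => Finset.sum_congr rfl fun s _ => ?_
        rw [Finset.mul_sum, Finset.mul_sum, Finset.sum_mul, Finset.sum_smul]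
        refine Finset.sum_congr rfl fun σ _ => ?_
        rw [permMat]
        split_ifs with h
        · have h1 : (-1 : ℂ) ^ ((mpar m s + mpar m s) * (mpar m s + mpar m s)) = 1 :=
            Even.neg_one_pow (Even.mul_left ⟨_, rfl⟩ _)
          rw [h, hmpar, h1, smul_smul, pow_add]
          congr 1
          ring
        · simp
    _ = _ := by
        simp only [Finset.smul_sum]
        rw [Finset.sum_comm, Finset.sum_comm (s := (Finset.univ : Finset (Equiv.Perm (Fin k))))]
        refine Finset.sum_congr rfl fun s _ => ?_
        rw [Finset.sum_comm]
        refine Finset.sum_congr rfl fun σ _ => ?_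
        rw [Finset.sum_ite_eq', if_pos (Finset.mem_univ _)]

/-- The series `T_{ab}(u - z)`. -/
def shiftedSeries (m n : ℕ) (z : ℂ) (a b : Fin (m + n)) : PowerSeries (Yangian m n) :=
  PowerSeries.mk fun p => ∑ s ∈ Finset.range (p + 1),
    algebraMap ℂ (Yangian m n) (shiftCoeff z p s) * TT m n a b s

/-- The coefficients of the series `T_{s₁t₁}(u) T_{s₂t₂}(u-1) ⋯ T_{sₖtₖ}(u-k+1)`. -/
def seriesCoeff (m n : ℕ) {k : ℕ} (p : ℕ) (s t : Fin k → Fin (m + n)) : Yangian m n :=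
  PowerSeries.coeff p
    ((List.finRange k).map fun i : Fin k => shiftedSeries m n ((i : ℕ) : ℂ) (s i) (t i)).prod

lemma TsymProd_apply (m n k p : ℕ) (s t : Fin k → Fin (m + n)) :
    TsymProd m n k p s t =
      ((-1 : ℂ) ^ crossExp m s t (List.finRange k).reverse) • seriesCoeff m n p s t := by
  have h := serProd_embed_apply m (R := Yangian m n)
    (fun (i : Fin k) p a b => ∑ s ∈ Finset.range (p + 1),
      algebraMap ℂ (Yangian m n) (shiftCoeff ((i : ℕ) : ℂ) p s) * TT m n a b s)
    (l := (List.finRange k).reverse) (List.nodup_reverse.mpr (List.nodup_finRange k)) p s t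
  rw [if_pos fun w hw => absurd (List.mem_reverse.mpr (List.mem_finRange w)) hw,
    List.reverse_reverse, neg_one_pow_mul_eq_smul] at h
  exact h

lemma TwedgeProd_apply (m n k p : ℕ) (s t : Fin k → Fin (m + n)) :
    TwedgeProd m n k p s t =
      ((-1 : ℂ) ^ crossExp m s t (List.finRange k)) •
        seriesCoeff m n p (s ∘ Fin.rev) (t ∘ Fin.rev) := by
  have h := serProd_embed_apply m (R := Yangian m n)
    (fun (i : Fin k) p a b => ∑ s ∈ Finset.range (p + 1),
      algebraMap ℂ (Yangian m n) (shiftCoeff ((k : ℂ) - 1 - (i : ℕ)) p s) * TT m n a b s)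
    (l := List.finRange k) (List.nodup_finRange k) p s t
  rw [if_pos fun w hw => absurd (List.mem_finRange w) hw, neg_one_pow_mul_eq_smul] at h
  refine h.trans ?_
  rw [seriesCoeff, List.finRange_reverse, List.map_map]
  congr 4
  funext i
  have hi : (k : ℂ) - 1 - ((Fin.rev i : Fin k) : ℕ) = (i : ℕ) := by
    rw [Fin.val_rev, Nat.cast_sub i.isLt]
    push_cast
    ring
  simp only [Function.comp_apply, hi]
  rfl

lemma prod_map_smul {ι A : Type} [Ring A] [Algebra ℂ A] (e : ι → ℕ) (f : ι → A) (l : List ι) :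
    (l.map fun i => ((-1 : ℂ) ^ e i) • f i).prod = ((-1 : ℂ) ^ (l.map e).sum) • (l.map f).prod := by
  induction l with
  | nil => simp
  | cons i l ih =>
    simp only [List.map_cons, List.prod_cons, List.sum_cons, ih, smul_mul_smul_comm, pow_add]

lemma map_seriesCoeff (m n : ℕ) (vpi : Yangian m n →ₐ[ℂ] Yangian n m)
    (hvpi : ∀ (a b : Fin (m + n)) (s : ℕ),
      vpi (TT m n a b s) =
        ((-1 : ℂ) ^ (par n (dualIdx a) * par n (dualIdx b) + par n (dualIdx b))) •
          TT n m (dualIdx b) (dualIdx a) s) {k : ℕ} (p : ℕ) (s t : Fin k → Fin (m + n)) :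
    vpi (seriesCoeff m n p s t) =
      ((-1 : ℂ) ^ ∑ i, (par n (dualIdx (s i)) * par n (dualIdx (t i)) + par n (dualIdx (t i)))) •
        seriesCoeff n m p (dualIdx ∘ t) (dualIdx ∘ s) := by
  have hmap : ∀ (z : ℂ) (a b : Fin (m + n)),
      PowerSeries.map vpi.toRingHom (shiftedSeries m n z a b) =
        ((-1 : ℂ) ^ (par n (dualIdx a) * par n (dualIdx b) + par n (dualIdx b))) •
          shiftedSeries n m z (dualIdx b) (dualIdx a) := by
    intro z a b
    ext q
    rw [PowerSeries.coeff_map]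
    simp only [shiftedSeries, PowerSeries.coeff_mk, PowerSeries.coeff_smul, map_sum, map_mul]
    rw [Finset.smul_sum]
    refine Finset.sum_congr rfl fun j _ => ?_
    simp only [AlgHom.toRingHom_eq_coe, RingHom.coe_coe, AlgHom.commutes, hvpi, mul_smul_comm]
  have h : vpi (seriesCoeff m n p s t) = PowerSeries.coeff p (PowerSeries.map vpi.toRingHom
      ((List.finRange k).map fun i : Fin k => shiftedSeries m n ((i : ℕ) : ℂ) (s i) (t i)).prod) := by
    rw [PowerSeries.coeff_map]
    rfl
  rw [h, map_list_prod, List.map_map]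
  simp only [Function.comp_def, hmap]
  rw [prod_map_smul, PowerSeries.coeff_smul, ← List.ofFn_eq_map, List.sum_ofFn]
  rfl

lemma transferS_eq (m n k : ℕ) (hk : 1 ≤ k) (d : Fin (m + n) → ℂ) (p : ℕ) :
    transferS m n k (Matrix.diagonal d) p =
      ((k.factorial : ℂ))⁻¹ • ∑ σ : Equiv.Perm (Fin k), ∑ s : Fin k → Fin (m + n),
        ((-1) ^ (mpar m s + invExp m (· < ·) σ s +
            crossExp m s (s ∘ σ.symm) (List.finRange k).reverse) * ∏ v, d (s v)) •
          seriesCoeff m n p s (s ∘ σ.symm) := by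
  have h := strace_sMul_kron_diagonal (R := Yangian m n) m (k := k) ((k.factorial : ℂ))⁻¹
    (fun _ => 1) d (TsymProd m n k p)
  simp only [one_smul, one_mul] at h
  rw [transferS, if_neg (by omega), symmZ, h]
  simp only [TsymProd_apply, smul_smul]
  refine congrArg _ (Finset.sum_congr rfl fun σ _ => Finset.sum_congr rfl fun s _ => ?_)
  congr 1
  rw [pow_add _ (_ + _)]
  ring

lemma transferT_eq (m n k : ℕ) (hk : 1 ≤ k) (d : Fin (m + n) → ℂ) (p : ℕ) :
    transferT m n k (Matrix.diagonal d) p =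
      ((k.factorial : ℂ))⁻¹ • ∑ σ : Equiv.Perm (Fin k), ∑ s : Fin k → Fin (m + n),
        ((-1) ^ ((Finset.univ.filter fun p : Fin k × Fin k => p.1 < p.2 ∧ σ p.2 < σ p.1).card +
            mpar m s + invExp m (· < ·) σ s +
            crossExp m s (s ∘ σ.symm) (List.finRange k)) * ∏ v, d (s v)) •
          seriesCoeff m n p (s ∘ Fin.rev) (s ∘ σ.symm ∘ Fin.rev) := by
  have h := strace_sMul_kron_diagonal (R := Yangian m n) m (k := k) ((k.factorial : ℂ))⁻¹
    (fun σ => (((Equiv.Perm.sign σ : ℤ) : ℂ))) d (TwedgeProd m n k p)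
  rw [transferT, if_neg (by omega), asymmZ, h]
  simp only [TwedgeProd_apply, smul_smul, sign_eq_neg_one_pow, Function.comp_assoc]
  refine congrArg _ (Finset.sum_congr rfl fun σ _ => Finset.sum_congr rfl fun s _ => ?_)
  congr 1
  simp only [pow_add]
  ring

lemma par_dualIdx {m n : ℕ} (a : Fin (m + n)) :
    ((par n (dualIdx a) : ℕ) : ZMod 2) = 1 + (par m a : ℕ) := by
  have hval : (dualIdx a : ℕ) = m + n - (a + 1) := by simp [dualIdx, Fin.val_rev]
  have := a.isLt
  simp only [par, parN, hval]
  by_cases h : (a : ℕ) < m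
  · rw [if_pos h, if_neg (by omega)]
    simp
  · rw [if_neg h, if_pos (by omega)]
    rfl

/-- The permutation `σ⁻¹`, conjugated by the reversal of the sites. -/
def dualPerm {k : ℕ} (σ : Equiv.Perm (Fin k)) : Equiv.Perm (Fin k) :=
  Fin.revPerm * σ⁻¹ * Fin.revPerm

lemma dualPerm_apply {k : ℕ} (σ : Equiv.Perm (Fin k)) (i : Fin k) :
    dualPerm σ i = (σ.symm i.rev).rev := rfl

lemma dualPerm_symm_apply {k : ℕ} (σ : Equiv.Perm (Fin k)) (i : Fin k) :
    (dualPerm σ).symm i = (σ i.rev).rev := rfl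

lemma dualPerm_involutive (k : ℕ) : Function.Involutive (dualPerm (k := k)) := fun σ =>
  Equiv.ext fun i => by
    rw [dualPerm_apply, dualPerm_symm_apply, Fin.rev_rev, Fin.rev_rev]

/-- The multi-index for `gl_{n|m}` dual to the column multi-index `s ∘ σ⁻¹`. -/
def dualRow {m n k : ℕ} (σ : Equiv.Perm (Fin k)) (s : Fin k → Fin (m + n)) : Fin k → Fin (n + m) :=
  dualIdx ∘ s ∘ σ.symm ∘ Fin.rev

lemma dualRow_comp_rev {m n k : ℕ} (σ : Equiv.Perm (Fin k)) (s : Fin k → Fin (m + n)) :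
    dualRow σ s ∘ Fin.rev = dualIdx ∘ s ∘ σ.symm := by
  funext i
  simp [dualRow]

lemma dualRow_comp_dualPerm_symm {m n k : ℕ} (σ : Equiv.Perm (Fin k)) (s : Fin k → Fin (m + n)) :
    dualRow σ s ∘ (dualPerm σ).symm = dualIdx ∘ s ∘ Fin.rev := by
  funext i
  simp [dualRow, dualPerm_symm_apply]

lemma dualRow_bijective {m n k : ℕ} (σ : Equiv.Perm (Fin k)) :
    Function.Bijective (dualRow (m := m) (n := n) σ) :=
  ((σ.trans Fin.revPerm).arrowCongr (Fin.revPerm.trans (finCongr (Nat.add_comm m n)))).bijective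

lemma sum_dualPerm_dualRow {m n k : ℕ} {A : Type} [AddCommMonoid A]
    (F : Equiv.Perm (Fin k) → (Fin k → Fin (n + m)) → A) :
    ∑ σ, ∑ s, F σ s =
      ∑ σ : Equiv.Perm (Fin k), ∑ s : Fin k → Fin (m + n), F (dualPerm σ) (dualRow σ s) := by
  rw [← Function.Bijective.sum_comp (dualPerm_involutive k).bijective]
  exact Finset.sum_congr rfl fun σ _ => ((dualRow_bijective σ).sum_comp (F (dualPerm σ))).symm

lemma prod_dualRow {m n k : ℕ} (d : Fin (m + n) → ℂ) (σ : Equiv.Perm (Fin k))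
    (s : Fin k → Fin (m + n)) :
    ∏ v, d (Fin.cast (Nat.add_comm n m) (dualRow σ s v).rev) = ∏ v, d (s v) := by
  rw [← Equiv.prod_comp (σ.trans Fin.revPerm)]
  refine Finset.prod_congr rfl fun v _ => congrArg d (Fin.ext ?_)
  have := (s v).isLt
  simp [dualRow, dualIdx, Fin.val_rev]
  omega

lemma sum_inversions_dualPerm {k : ℕ} (σ : Equiv.Perm (Fin k)) (f : Fin k → Fin k → ZMod 2) :
    (∑ i, ∑ j, if i < j ∧ dualPerm σ j < dualPerm σ i then f i j else 0) =
      ∑ i, ∑ j, if i < j ∧ σ j < σ i then f (σ i).rev (σ j).rev else 0 := by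
  rw [← Equiv.sum_comp (σ.trans Fin.revPerm)]
  refine Finset.sum_congr rfl fun i _ => ?_
  rw [← Equiv.sum_comp (σ.trans Fin.revPerm)]
  refine Finset.sum_congr rfl fun j _ => ?_
  simp [dualPerm_apply, and_comm]

lemma cast_invExp (m : ℕ) {N k : ℕ} (σ : Equiv.Perm (Fin k)) (s : Fin k → Fin N) :
    ((invExp m (· < ·) σ s : ℕ) : ZMod 2) =
      ∑ i, ∑ j, if i < j ∧ σ j < σ i then (par m (s i) : ZMod 2) * par m (s j) else 0 := by
  rw [invExp, Finset.sum_filter, Fintype.sum_prod_type]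
  push_cast
  rfl

lemma cast_card_inversions {k : ℕ} (σ : Equiv.Perm (Fin k)) :
    (((Finset.univ.filter fun p : Fin k × Fin k => p.1 < p.2 ∧ σ p.2 < σ p.1).card : ℕ) : ZMod 2) =
      ∑ i, ∑ j, if i < j ∧ σ j < σ i then 1 else 0 := by
  rw [Finset.card_filter, Fintype.sum_prod_type]
  push_cast
  rfl

lemma cast_crossExp_finRange_reverse (m : ℕ) {N k : ℕ} (s t : Fin k → Fin N) :
    ((crossExp m s t (List.finRange k).reverse : ℕ) : ZMod 2) =
      ∑ j, ((par m (s j) : ZMod 2) + par m (t j)) *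
        ∑ i, if i < j then (par m (s i) : ZMod 2) else 0 := by
  rw [crossExp_finRange_reverse]
  simp only [Finset.sum_filter]
  push_cast
  rfl

lemma cast_crossExp_finRange (m : ℕ) {N k : ℕ} (s t : Fin k → Fin N) :
    ((crossExp m s t (List.finRange k) : ℕ) : ZMod 2) =
      (crossExp m s t (List.finRange k).reverse : ℕ) +
      ∑ i, ((par m (s i) : ZMod 2) + par m (t i)) *
        ∑ j, if i < j then (par m (s j) : ZMod 2) + par m (t j) else 0 := by
  rw [crossExp_finRange, crossExp_finRange_reverse]
  push_cast
  rw [← Finset.sum_add_distrib]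
  simp only [mul_add, Finset.sum_filter]

lemma cast_crossExp_dual_finRange_reverse {m n k : ℕ} (σ : Equiv.Perm (Fin k))
    (s : Fin k → Fin (m + n)) :
    ((crossExp n (dualRow σ s) (dualRow σ s ∘ (dualPerm σ).symm) (List.finRange k).reverse : ℕ) :
        ZMod 2) =
      ∑ i, ((par m (s i) : ZMod 2) + par m (s (σ.symm i))) *
        ∑ j, if i < j then 1 + (par m (s (σ.symm j)) : ZMod 2) else 0 := by
  have two : (2 : ZMod 2) = 0 := rfl
  rw [cast_crossExp_finRange_reverse, ← Equiv.sum_comp Fin.revPerm, dualRow_comp_dualPerm_symm]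
  refine Finset.sum_congr rfl fun i _ => ?_
  rw [← Equiv.sum_comp Fin.revPerm]
  simp only [dualRow, Function.comp_apply, Fin.revPerm_apply, Fin.rev_rev, Fin.rev_lt_rev,
    par_dualIdx]
  linear_combination (∑ j, if i < j then 1 + (par m (s (σ.symm j)) : ZMod 2) else 0) *
    two

lemma cast_crossExp_dual_finRange {m n k : ℕ} (σ : Equiv.Perm (Fin k))
    (s : Fin k → Fin (m + n)) :
    ((crossExp n (dualRow σ s) (dualRow σ s ∘ (dualPerm σ).symm) (List.finRange k) : ℕ) :
        ZMod 2) =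
      (crossExp n (dualRow σ s) (dualRow σ s ∘ (dualPerm σ).symm) (List.finRange k).reverse : ℕ) +
      ∑ i, ((par m (s i) : ZMod 2) + par m (s (σ.symm i))) *
        ∑ j, if i < j then (par m (s j) : ZMod 2) + par m (s (σ.symm j)) else 0 := by
  have two : (2 : ZMod 2) = 0 := rfl
  rw [cast_crossExp_finRange, ← Equiv.sum_comp Fin.revPerm, dualRow_comp_dualPerm_symm]
  congr 1
  simp only [Finset.mul_sum]
  rw [Finset.sum_comm, ← Equiv.sum_comp Fin.revPerm]
  refine Finset.sum_congr rfl fun i _ => Finset.sum_congr rfl fun j _ => ?_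
  simp only [dualRow, Function.comp_apply, Fin.revPerm_apply, Fin.rev_rev, Fin.rev_lt_rev,
    par_dualIdx]
  split_ifs
  · linear_combination (2 + (par m (s i) : ZMod 2) + par m (s j) + par m (s (σ.symm i)) +
      par m (s (σ.symm j))) * two
  · ring

lemma parity_dual {m n k : ℕ} (σ : Equiv.Perm (Fin k)) (s : Fin k → Fin (m + n)) :
    ((mpar m s + invExp m (· < ·) σ s + crossExp m s (s ∘ σ.symm) (List.finRange k).reverse +
      ∑ i, (par n (dualIdx (s i)) * par n (dualIdx (s (σ.symm i))) +
        par n (dualIdx (s (σ.symm i)))) : ℕ) : ZMod 2) =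
    (k + ((Finset.univ.filter fun p : Fin k × Fin k =>
          p.1 < p.2 ∧ dualPerm σ p.2 < dualPerm σ p.1).card +
      mpar n (dualRow σ s) + invExp n (· < ·) (dualPerm σ) (dualRow σ s) +
      crossExp n (dualRow σ s) (dualRow σ s ∘ (dualPerm σ).symm) (List.finRange k)) : ℕ) := by
  have h := parity_identity σ (fun i => (par m (s i) : ZMod 2))
    (fun i => (par m (s (σ.symm i)) : ZMod 2)) (fun i => by rw [σ.symm_apply_apply])
  have hmpar : ((mpar n (dualRow σ s) : ℕ) : ZMod 2) =
      ∑ i, (1 + (par m (s (σ.symm i)) : ZMod 2)) := by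
    rw [mpar, ← Equiv.sum_comp Fin.revPerm]
    push_cast
    simp only [dualRow, Function.comp_apply, Fin.revPerm_apply, Fin.rev_rev, par_dualIdx]
  have hinv : ((invExp n (· < ·) (dualPerm σ) (dualRow σ s) : ℕ) : ZMod 2) =
      ∑ i, ∑ j, if i < j ∧ σ j < σ i then
        (1 + (par m (s i) : ZMod 2)) * (1 + (par m (s j) : ZMod 2)) else 0 := by
    rw [cast_invExp, sum_inversions_dualPerm]
    simp only [dualRow, Function.comp_apply, Fin.rev_rev, par_dualIdx, σ.symm_apply_apply]
  push_cast
  rw [cast_invExp, cast_crossExp_finRange_reverse, cast_card_inversions,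
    sum_inversions_dualPerm σ fun _ _ => 1, hmpar, hinv, cast_crossExp_dual_finRange,
    cast_crossExp_dual_finRange_reverse]
  simp only [par_dualIdx, mpar, Function.comp_apply]
  push_cast
  linear_combination h

lemma parity_dual' {m n k : ℕ} (σ : Equiv.Perm (Fin k)) (s : Fin k → Fin (m + n)) :
    (((Finset.univ.filter fun p : Fin k × Fin k => p.1 < p.2 ∧ σ p.2 < σ p.1).card +
      mpar m s + invExp m (· < ·) σ s + crossExp m s (s ∘ σ.symm) (List.finRange k) +
      ∑ i, (par n (dualIdx (s i)) * par n (dualIdx (s (σ.symm i))) +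
        par n (dualIdx (s (σ.symm i)))) : ℕ) : ZMod 2) =
    (k + (mpar n (dualRow σ s) + invExp n (· < ·) (dualPerm σ) (dualRow σ s) +
      crossExp n (dualRow σ s) (dualRow σ s ∘ (dualPerm σ).symm) (List.finRange k).reverse) : ℕ) := by
  have h := parity_dual σ s
  have two : (2 : ZMod 2) = 0 := rfl
  have hcard := sum_inversions_dualPerm σ fun _ _ => 1
  rw [← cast_card_inversions, ← cast_card_inversions] at hcard
  push_cast at h ⊢
  rw [cast_crossExp_finRange]
  rw [cast_crossExp_dual_finRange, hcard] at h
  simp only [Function.comp_apply]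
  linear_combination h + (((Finset.univ.filter fun p : Fin k × Fin k =>
      p.1 < p.2 ∧ σ p.2 < σ p.1).card : ZMod 2) +
    ∑ i, ((par m (s i) : ZMod 2) + par m (s (σ.symm i))) *
        ∑ j, if i < j then (par m (s j) : ZMod 2) + par m (s (σ.symm j)) else 0) *
    two

theorem statement12 (m n : ℕ) (d : Fin (m + n) → ℂ)
    (vpi : Yangian m n →ₐ[ℂ] Yangian n m)
    (hvpi : ∀ (a b : Fin (m + n)) (s : ℕ),
      vpi (TT m n a b s) =
        ((-1 : ℂ) ^ (par n (dualIdx a) * par n (dualIdx b) + par n (dualIdx b))) •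
          TT n m (dualIdx b) (dualIdx a) s) :
    ∀ k : ℕ, 1 ≤ k → ∀ p : ℕ,
      (vpi (transferS m n k (Matrix.diagonal d) p)
          = ((-1 : ℂ) ^ k) •
            transferT n m k (Matrix.diagonal fun c => d (Fin.cast (Nat.add_comm n m) c.rev)) p)
      ∧ (vpi (transferT m n k (Matrix.diagonal d) p)
          = ((-1 : ℂ) ^ k) •
            transferS n m k (Matrix.diagonal fun c => d (Fin.cast (Nat.add_comm n m) c.rev)) p) := by
  intro k hk p
  constructor
  · rw [transferS_eq m n k hk, transferT_eq n m k hk, map_smul, smul_comm,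
      sum_dualPerm_dualRow (m := m) (n := n)]
    refine congrArg _ ?_
    rw [map_sum, Finset.smul_sum]
    refine Finset.sum_congr rfl fun σ _ => ?_
    rw [map_sum, Finset.smul_sum]
    refine Finset.sum_congr rfl fun s _ => ?_
    rw [map_smul, map_seriesCoeff m n vpi hvpi, ← Function.comp_assoc (dualRow σ s),
      dualRow_comp_dualPerm_symm, dualRow_comp_rev, prod_dualRow d σ s, smul_smul, smul_smul]
    congr 1
    · rw [mul_right_comm, ← mul_assoc, ← pow_add, ← pow_add]
      congr 1
      have h := parity_dual σ s
      rw [dualRow_comp_dualPerm_symm] at h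
      exact neg_one_pow_eq_of_zmod h
    · congr 1
      funext i
      simp
  · rw [transferT_eq m n k hk, transferS_eq n m k hk, map_smul, smul_comm,
      sum_dualPerm_dualRow (m := m) (n := n)]
    refine congrArg _ ?_
    rw [map_sum, Finset.smul_sum]
    refine Finset.sum_congr rfl fun σ _ => ?_
    rw [map_sum, Finset.smul_sum]
    refine Finset.sum_congr rfl fun s _ => ?_
    have hsum := Equiv.sum_comp Fin.revPerm fun i => par n (dualIdx (s i)) *
      par n (dualIdx (s (σ.symm i))) + par n (dualIdx (s (σ.symm i)))
    simp only [Fin.revPerm_apply] at hsum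
    rw [map_smul, map_seriesCoeff m n vpi hvpi, prod_dualRow d σ s, smul_smul, smul_smul]
    simp only [Function.comp_apply]
    rw [hsum, mul_right_comm, ← mul_assoc, ← pow_add, ← pow_add,
      neg_one_pow_eq_of_zmod (parity_dual' σ s), dualRow_comp_dualPerm_symm]
    rfl

end Paper
end
end
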